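/- Let A : ℝ^d → ℝ be convex and differentiable, let λ > 0, let n, K ≥ 1, and let t_1, …, t_n ∈ ℝ^d and c_1, …, c_n ∈ ℝ. For Θ = (θ_1, …, θ_K) ∈ (ℝ^d)^K define the cost matrix M(Θ)_{ij} := c_i + A(θ_j) − ⟨t_i, θ_j⟩, and for ω in the simplex Δ^K define g(ω, Θ) := inf { Σ_{i,j} π_{ij} M(Θ)_{ij} + λ Σ_{i,j} π_{ij} log π_{ij} : π ∈ ℝ^{n×K}, π_{ij} ≥ 0, Σ_j π_{ij} = 1/n for all i, Σ_i π_{ij} = ω_j for all j }. Given any (ω, Θ), define π'_{ij} := (1/n)·exp(−M(Θ)_{ij}/λ) / Σ_{k=1}^K exp(−M(Θ)_{ik}/λ), set ω'_j := Σ_{i=1}^n π'_{ij} (note ω'_j > 0 and Σ_j ω'_j = 1), and let Θ' = (θ'_1, …, θ'_K) be any tuple satisfying ω'_j · ∇A(θ'_j) = Σ_{i=1}^n π'_{ij} t_i for every j. Then g(ω', Θ') ≤ g(ω, Θ). -/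

import Mathlib

open Finset
open scoped RealInnerProductSpace

/-- First-order condition for convexity: a convex function lies above its tangent hyperplanes. -/
theorem ConvexOn.add_inner_gradient_le {E : Type*} [NormedAddCommGroup E] [InnerProductSpace ℝ E]
    [CompleteSpace E] {f : E → ℝ} {x : E} (hf : ConvexOn ℝ Set.univ f)
    (hx : DifferentiableAt ℝ f x) (y : E) :
    f x + ⟪gradient f x, y - x⟫ ≤ f y := by
  have hline : HasDerivAt (f ∘ AffineMap.lineMap (k := ℝ) x y) (fderiv ℝ f x (y - x)) 0 := by
    refine HasFDerivAt.comp_hasDerivAt (0 : ℝ) ?_ AffineMap.hasDerivAt_lineMap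
    simpa using hx.hasFDerivAt
  have hslope := (hf.comp_affineMap (AffineMap.lineMap (k := ℝ) x y)).le_slope_of_hasDerivAt
    (Set.mem_univ 0) (Set.mem_univ 1) one_pos hline
  simp only [slope_def_field, Function.comp_apply, AffineMap.lineMap_apply_zero,
    AffineMap.lineMap_apply_one, sub_zero, div_one] at hslope
  rw [inner_gradient_left]
  linarith

/-- Tangent-line inequality for `x ↦ x log x`, with the convention `0 log 0 = 0`. -/
theorem Real.mul_log_add_sub_le_mul_log {x p : ℝ} (hx : 0 ≤ x) (hp : 0 < p) :
    x * Real.log p + (x - p) ≤ x * Real.log x := by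
  rcases hx.eq_or_lt with rfl | hx
  · simp [hp.le]
  · have h := mul_le_mul_of_nonneg_left (Real.log_le_sub_one_of_pos (div_pos hp hx)) hx.le
    rw [Real.log_div hp.ne' hx.ne', mul_sub, mul_sub, mul_div_cancel₀ _ hx.ne'] at h
    linarith

section Gibbs

variable {ι : Type*} [Fintype ι] {lam s : ℝ} {m p : ι → ℝ}

/-- Logarithm of a Gibbs weight: `m + λ log p` does not depend on the index. -/
theorem add_mul_log_gibbs (hlam : lam ≠ 0) (hs : 0 < s)
    (hp : ∀ j, p j = s * Real.exp (-m j / lam) / ∑ k, Real.exp (-m k / lam)) (j : ι) :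
    m j + lam * Real.log (p j) = lam * Real.log (s / ∑ k, Real.exp (-m k / lam)) := by
  have hZ : 0 < ∑ k, Real.exp (-m k / lam) :=
    sum_pos (fun _ _ => Real.exp_pos _) ⟨j, mem_univ j⟩
  rw [hp, mul_div_right_comm, Real.log_mul (div_pos hs hZ).ne' (Real.exp_pos _).ne', Real.log_exp]
  field_simp
  ring

theorem sum_gibbs [Nonempty ι]
    (hp : ∀ j, p j = s * Real.exp (-m j / lam) / ∑ k, Real.exp (-m k / lam)) :
    ∑ j, p j = s := by
  have hZ : 0 < ∑ k, Real.exp (-m k / lam) := sum_pos (fun _ _ => Real.exp_pos _) univ_nonempty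
  simp_rw [hp, ← sum_div, ← mul_sum]
  exact mul_div_cancel_right₀ _ hZ.ne'

theorem gibbs_pos (hs : 0 < s)
    (hp : ∀ j, p j = s * Real.exp (-m j / lam) / ∑ k, Real.exp (-m k / lam)) (j : ι) :
    0 < p j := by
  rw [hp]
  exact div_pos (mul_pos hs (Real.exp_pos _)) (sum_pos (fun _ _ => Real.exp_pos _) ⟨j, mem_univ j⟩)

/-- Gibbs variational principle: the Gibbs weights minimize the entropic cost among nonnegative
weights of the same total mass. -/
theorem entropic_cost_gibbs_le [Nonempty ι] (hlam : 0 < lam) (hs : 0 < s)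
    (hp : ∀ j, p j = s * Real.exp (-m j / lam) / ∑ k, Real.exp (-m k / lam))
    {q : ι → ℝ} (hq : ∀ j, 0 ≤ q j) (hqs : ∑ j, q j = s) :
    ∑ j, p j * m j + lam * ∑ j, p j * Real.log (p j) ≤
      ∑ j, q j * m j + lam * ∑ j, q j * Real.log (q j) := by
  have hps := sum_gibbs hp
  have hconst := add_mul_log_gibbs hlam.ne' hs hp
  set C := lam * Real.log (s / ∑ k, Real.exp (-m k / lam))
  have hval : ∀ r : ι → ℝ, ∑ j, r j = s →
      ∑ j, r j * m j + lam * ∑ j, r j * Real.log (p j) = s * C := fun r hr => by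
    rw [← hr, sum_mul, mul_sum, ← sum_add_distrib]
    refine sum_congr rfl fun j _ => ?_
    rw [← hconst j]
    ring
  have htangent : ∑ j, q j * Real.log (p j) ≤ ∑ j, q j * Real.log (q j) := by
    have h := sum_le_sum fun j (_ : j ∈ univ) =>
      Real.mul_log_add_sub_le_mul_log (hq j) (gibbs_pos hs hp j)
    simpa [sum_add_distrib, sum_sub_distrib, hqs, hps] using h
  rw [hval p hps, ← hval q hqs]
  gcongr

end Gibbs

/-- One iteration of Algorithm 1 (softmax transportation plan, column-sum weights,
moment-matching atoms) does not increase the entropic-regularized composite transportation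
objective `g(ω, Θ)`: for the cost matrix `M(Θ)_{ij} = c_i + A(θ_j) − ⟨t_i, θ_j⟩` and
`g(ω, Θ) = inf { Σ π_{ij} M(Θ)_{ij} + λ Σ π_{ij} log π_{ij} : π ≥ 0, row sums 1/n,
column sums ω }`, the updated `(ω', Θ')` satisfies `ω'_j > 0`, `Σ_j ω'_j = 1`, and
`g(ω', Θ') ≤ g(ω, Θ)`. -/
theorem stmt_11 {d : ℕ} (A : EuclideanSpace ℝ (Fin d) → ℝ)
    (hA : ConvexOn ℝ Set.univ A) (hA' : Differentiable ℝ A)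
    (lam : ℝ) (hlam : 0 < lam)
    (n K : ℕ) (hn : 1 ≤ n) (hK : 1 ≤ K)
    (t : Fin n → EuclideanSpace ℝ (Fin d)) (c : Fin n → ℝ)
    (M : (Fin K → EuclideanSpace ℝ (Fin d)) → Fin n → Fin K → ℝ)
    (hM : ∀ Θ i j, M Θ i j = c i + A (Θ j) - ⟪t i, Θ j⟫)
    (g : (Fin K → ℝ) → (Fin K → EuclideanSpace ℝ (Fin d)) → ℝ)
    (hg : ∀ ω Θ, g ω Θ = sInf {x : ℝ | ∃ π : Fin n → Fin K → ℝ,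
      (∀ i j, 0 ≤ π i j) ∧ (∀ i, ∑ j, π i j = 1 / (n : ℝ)) ∧ (∀ j, ∑ i, π i j = ω j) ∧
      x = ∑ i, ∑ j, π i j * M Θ i j + lam * ∑ i, ∑ j, π i j * Real.log (π i j)})
    (ω : Fin K → ℝ) (hω : (∀ j, 0 ≤ ω j) ∧ ∑ j, ω j = 1)
    (Θ : Fin K → EuclideanSpace ℝ (Fin d))
    (π' : Fin n → Fin K → ℝ)
    (hπ' : ∀ i j, π' i j =
      (1 / (n : ℝ)) * Real.exp (-M Θ i j / lam) / ∑ k, Real.exp (-M Θ i k / lam))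
    (ω' : Fin K → ℝ) (hω' : ∀ j, ω' j = ∑ i, π' i j)
    (Θ' : Fin K → EuclideanSpace ℝ (Fin d))
    (hΘ' : ∀ j, ω' j • gradient A (Θ' j) = ∑ i, π' i j • t i) :
    (∀ j, 0 < ω' j) ∧ (∑ j, ω' j = 1) ∧ g ω' Θ' ≤ g ω Θ := by
  have hn0 : (0 : ℝ) < n := by exact_mod_cast hn
  have hs : 0 < 1 / (n : ℝ) := one_div_pos.mpr hn0
  have : Nonempty (Fin n) := ⟨⟨0, hn⟩⟩
  have : Nonempty (Fin K) := ⟨⟨0, hK⟩⟩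
  have hpos : ∀ i j, 0 < π' i j := fun i => gibbs_pos hs (hπ' i)
  have hrow : ∀ i, ∑ j, π' i j = 1 / (n : ℝ) := fun i => sum_gibbs (hπ' i)
  have hωpos : ∀ j, 0 < ω' j := fun j => by
    rw [hω']
    exact sum_pos (fun i _ => hpos i j) univ_nonempty
  have hωsum : ∑ j, ω' j = 1 := by
    simp_rw [hω']
    rw [sum_comm]
    simp [hrow, hn0.ne']
  refine ⟨hωpos, hωsum, ?_⟩
  -- The softmax plan minimizes the objective once the column constraint is dropped.
  have hgibbs : ∀ (Ψ : Fin K → EuclideanSpace ℝ (Fin d)) (p π : Fin n → Fin K → ℝ),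
      (∀ i j, p i j =
        (1 / (n : ℝ)) * Real.exp (-M Ψ i j / lam) / ∑ k, Real.exp (-M Ψ i k / lam)) →
      (∀ i j, 0 ≤ π i j) → (∀ i, ∑ j, π i j = 1 / (n : ℝ)) →
      ∑ i, ∑ j, p i j * M Ψ i j + lam * ∑ i, ∑ j, p i j * Real.log (p i j) ≤
        ∑ i, ∑ j, π i j * M Ψ i j + lam * ∑ i, ∑ j, π i j * Real.log (π i j) :=
    fun Ψ p π hp hπ hπs => by
      rw [mul_sum, mul_sum, ← sum_add_distrib, ← sum_add_distrib]
      exact sum_le_sum fun i _ => entropic_cost_gibbs_le hlam hs (hp i) (hπ i) (hπs i)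
  -- The moment-matching atoms minimize the cost of the softmax plan.
  have hatoms : ∑ i, ∑ j, π' i j * M Θ' i j ≤ ∑ i, ∑ j, π' i j * M Θ i j := by
    rw [sum_comm, sum_comm (f := fun i j => π' i j * M Θ i j)]
    refine sum_le_sum fun j _ => ?_
    have hcol : ∀ Ψ : Fin K → EuclideanSpace ℝ (Fin d), ∑ i, π' i j * M Ψ i j =
        ∑ i, π' i j * c i + ω' j * (A (Ψ j) - ⟪gradient A (Θ' j), Ψ j⟫) := fun Ψ => by
      rw [mul_sub, ← real_inner_smul_left, hΘ', sum_inner, hω', sum_mul, ← sum_sub_distrib,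
        ← sum_add_distrib]
      refine sum_congr rfl fun i _ => ?_
      rw [hM, real_inner_smul_left]
      ring
    rw [hcol, hcol]
    have htangent := hA.add_inner_gradient_le (hA' (Θ' j)) (Θ j)
    rw [inner_sub_right] at htangent
    exact add_le_add le_rfl (mul_le_mul_of_nonneg_left (by linarith) (hωpos j).le)
  rw [hg ω' Θ', hg ω Θ]
  refine le_csInf ⟨_, fun _ j => ω j / n, fun _ j => div_nonneg (hω.1 j) hn0.le,
    fun _ => by rw [← sum_div, hω.2], fun j => ?_, rfl⟩ ?_
  · simp [mul_div_cancel₀ _ hn0.ne']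
  · rintro _ ⟨π, hπ, hπs, -, rfl⟩
    refine le_trans (csInf_le ?_ ⟨π', fun i j => (hpos i j).le, hrow, fun j => (hω' j).symm, rfl⟩)
      (le_trans (add_le_add_left hatoms _) (hgibbs Θ π' π hπ' hπ hπs))
    let p : Fin n → Fin K → ℝ := fun i j =>
      (1 / (n : ℝ)) * Real.exp (-M Θ' i j / lam) / ∑ k, Real.exp (-M Θ' i k / lam)
    refine ⟨∑ i, ∑ j, p i j * M Θ' i j + lam * ∑ i, ∑ j, p i j * Real.log (p i j), ?_⟩
    rintro _ ⟨ρ, hρ, hρs, -, rfl⟩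
    exact hgibbs Θ' p ρ (fun _ _ => rfl) hρ hρs
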